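/- arXiv:2602.17411 — 2 statements merged into one kernel-verified Lean document; each statement's English description precedes it below -/
import Mathlib

section
/- Let f ∈ F_2[t] be an irreducible polynomial with f ≠ t and f ≠ t+1 that is not self-reciprocal, and let R_f = F_2[t, t^{-1}, f(t)^{-1}]. Then the only ring automorphism of R_f is the identity. -/
open Polynomial in
lemma aux_eq_one_of_isUnit (p : (ZMod 2)[X]) (h : IsUnit p) : p = 1 := by
  obtain ⟨c, hc, rfl⟩ := Polynomial.isUnit_iff.mp h
  have : ∀ c : ZMod 2, c ≠ 0 → c = 1 := by decide
  rw [this c hc.ne_zero, C_1]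

open Polynomial in
lemma aux_assoc {p q : (ZMod 2)[X]} (h : Associated p q) : p = q := by
  obtain ⟨u, rfl⟩ := h
  rw [aux_eq_one_of_isUnit _ u.isUnit, mul_one]

open Polynomial in
lemma aux_prime_dvd {f p m : (ZMod 2)[X]} (hf : Irreducible f) (hp : Prime p)
    (hm : m ∈ Submonoid.closure {X, f}) (h : p ∣ m) : p = X ∨ p = f := by
  induction hm using Submonoid.closure_induction with
  | mem x hx =>
    rcases hx with rfl | rfl
    · exact Or.inl (aux_assoc (hp.irreducible.associated_of_dvd irreducible_X h))
    · exact Or.inr (aux_assoc (hp.irreducible.associated_of_dvd hf h))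
  | one => exact absurd (isUnit_of_dvd_one h) hp.not_isUnit
  | mul x y _ _ hx hy => exact (hp.dvd_or_dvd h).elim hx hy

open Polynomial in
lemma aux_small {f p m : (ZMod 2)[X]} (hf : Irreducible f)
    (hft1 : f ≠ X + 1) (hm : m ∈ Submonoid.closure {X, f}) (hp0 : p ≠ 0)
    (h : p ∣ m) (hd : p.natDegree ≤ 1) : p = 1 ∨ p = X := by
  have key : ∀ c : ZMod 2, c ≠ 0 → c = 1 := by decide
  have key2 : ∀ c : ZMod 2, c = 0 ∨ c = 1 := by decide
  rcases Nat.le_one_iff_eq_zero_or_eq_one.mp hd with h0 | h1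
  · left
    exact aux_eq_one_of_isUnit _ (isUnit_iff_degree_eq_zero.mpr
      (by rw [degree_eq_natDegree hp0, h0]; rfl))
  · right
    have hpr : Prime p := (irreducible_of_degree_eq_one
      (by rw [degree_eq_natDegree hp0, h1]; rfl)).prime
    rcases aux_prime_dvd hf hpr hm h with h | h
    · exact h
    · have e := eq_X_add_C_of_natDegree_le_one hd
      have hc : p.coeff 1 ≠ 0 := by
        rw [← h1]; exact leadingCoeff_ne_zero.mpr hp0
      rw [key _ hc] at e
      rcases key2 (p.coeff 0) with h2 | h2 <;> rw [h2] at e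
      · simpa using e
      · exact absurd (by rw [← h, e]; simp) hft1

open Polynomial in
lemma aux_rev {f m : (ZMod 2)[X]} (hf : Irreducible f) (hft : f ≠ X)
    (hm : m ∈ Submonoid.closure {X, f}) (h : f.reverse ∣ m) : f.reverse = f := by
  have hc0 : f.coeff 0 ≠ 0 := fun h0 =>
    hft (aux_assoc ((irreducible_X.associated_of_dvd hf (X_dvd_iff.mpr h0)))).symm
  have hr0 : f.reverse ≠ 0 := by simpa using hf.ne_zero
  have hdeg : f.reverse.natDegree = f.natDegree := by
    rw [reverse_natDegree, natTrailingDegree_eq_zero.mpr (Or.inr hc0), Nat.sub_zero]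
  have hnu : ¬ IsUnit f.reverse := fun hu => by
    have := natDegree_eq_zero_of_isUnit hu
    have h2 := hf.natDegree_pos
    omega
  obtain ⟨g, hg, hgd⟩ := WfDvdMonoid.exists_irreducible_factor hnu hr0
  rcases aux_prime_dvd hf hg.prime hm (hgd.trans h) with rfl | rfl
  · rw [X_dvd_iff, coeff_zero_reverse] at hgd
    exact absurd (leadingCoeff_eq_zero.mp hgd) hf.ne_zero
  · exact (aux_assoc (associated_of_dvd_of_natDegree_le hgd hr0 hdeg.le)).symm

/-- Statement 11: for an irreducible polynomial `f ∈ F₂[t]` with `f ≠ t`, `f ≠ t+1`,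
which is not self-reciprocal, the only ring automorphism of
`R_f = F₂[t, t⁻¹, f(t)⁻¹]` (the localization of `F₂[t]` at the multiplicative set
generated by `t` and `f`) is the identity. -/
theorem statement_11 (f : Polynomial (ZMod 2)) (hirr : Irreducible f)
    (hft : f ≠ Polynomial.X) (hft1 : f ≠ Polynomial.X + 1)
    (hrec : f.reverse ≠ f) :
    ∀ σ : Localization (Submonoid.closure {Polynomial.X, f}) ≃+*
        Localization (Submonoid.closure {Polynomial.X, f}),
      σ = RingEquiv.refl _ := by
  set M := Submonoid.closure {Polynomial.X, f} with hMdef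
  intro σ
  let P := Polynomial (ZMod 2)
  let K := RatFunc (ZMod 2)
  have hXM : (Polynomial.X : P) ∈ M := Submonoid.subset_closure (by simp)
  have hfM : f ∈ M := Submonoid.subset_closure (by simp)
  have hM : ∀ m ∈ M, m ≠ 0 := by
    intro m hm
    have : M ≤ nonZeroDivisors P := by
      rw [hMdef, Submonoid.closure_le]
      rintro x (rfl | rfl)
      · exact mem_nonZeroDivisors_of_ne_zero Polynomial.X_ne_zero
      · exact mem_nonZeroDivisors_of_ne_zero hirr.ne_zero
    exact nonZeroDivisors.ne_zero (this hm)
  have hinjA : Function.Injective (algebraMap P K) := IsFractionRing.injective P K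
  have hA0 : ∀ m ∈ M, algebraMap P K m ≠ 0 := fun m hm h =>
    hM m hm (hinjA (h.trans (map_zero _).symm))
  let ι : Localization M →+* K :=
    IsLocalization.lift (M := M) (g := algebraMap P K) (fun y => (hA0 y y.2).isUnit)
  have hι : ∀ p : P, ι (algebraMap P _ p) = algebraMap P K p := fun p =>
    IsLocalization.lift_eq _ p
  have hinj : Function.Injective ι := by
    rw [injective_iff_map_eq_zero]
    intro r hr
    obtain ⟨⟨p, m⟩, h⟩ := IsLocalization.surj M r
    simp only at h
    have h2 := congrArg ι h
    rw [map_mul, hr, zero_mul, hι] at h2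
    have hp : p = 0 := hinjA (h2.symm.trans (map_zero _).symm)
    rw [hp, map_zero] at h
    exact (IsLocalization.map_units (Localization M) m).mul_left_eq_zero.mp h
  have hunit : ∀ w : Localization M, IsUnit w → ∃ p p' m : P, m ∈ M ∧ p * p' ∈ M ∧
      ι w * algebraMap P K m = algebraMap P K p := by
    rintro w hw
    obtain ⟨w', hw'⟩ := hw.exists_right_inv
    obtain ⟨⟨p, m⟩, h⟩ := IsLocalization.surj M w
    obtain ⟨⟨p', m'⟩, h'⟩ := IsLocalization.surj M w'
    simp only at h h'
    have h1 := congrArg ι h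
    have h1' := congrArg ι h'
    have h3 := congrArg ι hw'
    rw [map_mul, hι, hι] at h1 h1'
    rw [map_mul, map_one] at h3
    refine ⟨p, p', m, m.2, ?_, h1⟩
    have : p * p' = m * m' := by
      apply hinjA
      rw [map_mul, map_mul, ← h1, ← h1']
      linear_combination (algebraMap P K m * algebraMap P K m') * h3
    rw [this]
    exact M.mul_mem m.2 m'.2
  set t : Localization M := algebraMap P _ Polynomial.X with ht
  have htu : IsUnit t := IsLocalization.map_units (Localization M) ⟨_, hXM⟩
  have hfu : IsUnit (algebraMap P (Localization M) f) :=
    IsLocalization.map_units (Localization M) ⟨_, hfM⟩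
  set u : K := ι (σ t) with hu
  have hφ : ∀ p : P, ι (σ (algebraMap P _ p)) = Polynomial.aeval u p := by
    intro p
    have : (ι.comp (σ : Localization M →+* Localization M)).comp (algebraMap P _) =
        (Polynomial.aeval u : P →ₐ[ZMod 2] K).toRingHom := by
      apply Polynomial.ringHom_ext'
      · exact Subsingleton.elim _ _
      · simp [hu, ht]
    exact RingHom.congr_fun this p
  have hmem : ∀ r, ι (σ r) ∈ IntermediateField.adjoin (ZMod 2) {u} := by
    intro r
    obtain ⟨⟨p, m⟩, h⟩ := IsLocalization.surj M r
    have h2 := congrArg (fun x => ι (σ x)) h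
    simp only [map_mul] at h2
    have hne : Polynomial.aeval u (m : P) ≠ 0 := by
      rw [← hφ]
      exact (((IsLocalization.map_units (Localization M) m).map σ).map ι).ne_zero
    rw [IntermediateField.mem_adjoin_simple_iff]
    exact ⟨p, m, by rw [eq_div_iff hne, ← hφ, ← hφ]; exact h2⟩
  have hX : (RatFunc.X : K) ∈ IntermediateField.adjoin (ZMod 2) {u} := by
    have := hmem (σ.symm t)
    rwa [σ.apply_symm_apply, ht, hι, RatFunc.algebraMap_X] at this
  have htop : IntermediateField.adjoin (ZMod 2) {u} = ⊤ := by
    rw [eq_top_iff, ← RatFunc.adjoin_X, IntermediateField.adjoin_simple_le_iff]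
    exact hX
  have hfin := RatFunc.finrank_eq_max_natDegree u
  rw [htop, IntermediateField.finrank_top] at hfin
  obtain ⟨p, p', m, hm, hpp, he⟩ := hunit (σ t) (htu.map σ)
  have hu' : u = algebraMap P K p / algebraMap P K m := by
    rw [eq_div_iff (hA0 m hm)]; exact he
  have hnum : u.num ∣ p * p' := by
    rw [hu']
    exact (RatFunc.num_div_dvd p (hM m hm)).trans (dvd_mul_right _ _)
  have hden : u.denom ∣ m := by
    rw [hu']
    exact RatFunc.denom_div_dvd p m
  have hu0 : u ≠ 0 := ((htu.map σ).map ι).ne_zero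
  have hn := aux_small hirr hft1 hpp (RatFunc.num_ne_zero hu0) hnum (by omega)
  have hd := aux_small hirr hft1 hm u.denom_ne_zero hden (by omega)
  have hq := RatFunc.num_div_denom u
  have hcop := RatFunc.isCoprime_num_denom u
  have hcase : u = RatFunc.X ∨ u = (RatFunc.X)⁻¹ := by
    rcases hn with hn | hn <;> rcases hd with hd | hd <;> rw [hn, hd] at hq hfin hcop
    · simp at hfin
    · right; rw [← hq]; simp
    · left; rw [← hq]; simp
    · exact absurd (isCoprime_self.mp hcop) Polynomial.not_isUnit_X
  rcases hcase with h | h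
  · have hσt : σ t = t := hinj (by rw [← hu, h, ht, hι, RatFunc.algebraMap_X])
    have : (σ : Localization M →+* Localization M) = RingHom.id _ := by
      apply IsLocalization.ringHom_ext M
      apply Polynomial.ringHom_ext'
      · exact Subsingleton.elim _ _
      · simpa using hσt
    ext r
    exact RingHom.congr_fun this r
  · exfalso
    apply hrec
    obtain ⟨q, q', n, hn, hqq, he⟩ := hunit _ (hfu.map σ)
    rw [hφ, h] at he
    have hX0 : (RatFunc.X : K) ≠ 0 := RatFunc.X_ne_zero
    have e1 : Polynomial.aeval (RatFunc.X : K)⁻¹ f * RatFunc.X ^ f.natDegree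
        = algebraMap P K f.reverse := by
      let _ : Invertible (RatFunc.X : K)⁻¹ :=
        ⟨RatFunc.X, mul_inv_cancel₀ hX0, inv_mul_cancel₀ hX0⟩
      have e := Polynomial.eval₂_reverse_mul_pow (algebraMap (ZMod 2) K)
        (RatFunc.X : K)⁻¹ f
      have e' : Polynomial.aeval (RatFunc.X : K) f.reverse * ((RatFunc.X : K)⁻¹) ^ f.natDegree
        = Polynomial.aeval (RatFunc.X : K)⁻¹ f := e
      rw [← e', mul_assoc, ← mul_pow, inv_mul_cancel₀ hX0, one_pow, mul_one,
        ← RatFunc.algebraMap_X, Polynomial.aeval_algebraMap_apply, Polynomial.aeval_X_left_apply]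
    have e2 : f.reverse * n = q * Polynomial.X ^ f.natDegree := by
      apply hinjA
      rw [map_mul, map_mul, map_pow, RatFunc.algebraMap_X, ← e1, ← he]
      ring
    apply aux_rev hirr hft (M.mul_mem hqq (M.pow_mem hXM f.natDegree))
    refine Dvd.dvd.trans (Dvd.intro _ e2) ⟨q', by ring⟩
end

section
/- Let R be an integral domain in which every element can be written as a finite sum of units. Let φ be an automorphism of the additive group (R,+) and let Φ be an automorphism of the multiplicative group of units U(R). If Φ(u)·φ(1) = φ(u) for all u ∈ U(R), then Φ extends to a ring automorphism of R; moreover φ(1) is a unit of R and the extension is given by r ↦ φ(r)·φ(1)^{-1}. -/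
/-- Statement 12: let `R` be an integral domain in which every element is a finite
sum of units, `φ` an automorphism of `(R,+)`, and `Φ` an automorphism of `Rˣ` with
`Φ(u)·φ(1) = φ(u)` for all units `u`.  Then `Φ` extends to a ring automorphism of
`R`; moreover `φ(1)` is a unit and the extension satisfies `Φ̄(r)·φ(1) = φ(r)`. -/
theorem statement_12 (R : Type*) [CommRing R] [IsDomain R]
    (hsum : ∀ r : R, r ∈ AddSubmonoid.closure {x : R | IsUnit x})
    (φ : R ≃+ R) (Φ : Rˣ ≃* Rˣ)
    (h : ∀ u : Rˣ, (Φ u : R) * φ 1 = φ u) :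
    IsUnit (φ 1) ∧
      ∃ Φbar : R ≃+* R, (∀ u : Rˣ, Φbar (u : R) = (Φ u : R)) ∧
        ∀ r : R, Φbar r * φ 1 = φ r := by
  have hdiv : ∀ r : R, φ 1 ∣ φ r := by
    intro r
    induction hsum r using AddSubmonoid.closure_induction with
    | mem x hx =>
      obtain ⟨u, rfl⟩ := hx
      exact ⟨Φ u, by rw [← h u, mul_comm]⟩
    | zero => simp
    | add x y _ _ hx hy => rw [map_add]; exact dvd_add hx hy
  have hunit : IsUnit (φ 1) := by
    have h1 := hdiv (φ.symm 1)
    rw [AddEquiv.apply_symm_apply] at h1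
    exact isUnit_of_dvd_one h1
  refine ⟨hunit, ?_⟩
  obtain ⟨c, hc⟩ := hunit
  have key : ∀ x y : R, φ (x * y) * φ 1 = φ x * φ y := by
    intro x y
    induction hsum x using AddSubmonoid.closure_induction with
    | mem x hx =>
      obtain ⟨u, rfl⟩ := hx
      induction hsum y using AddSubmonoid.closure_induction with
      | mem y hy =>
        obtain ⟨v, rfl⟩ := hy
        rw [← Units.val_mul, ← h, ← h, ← h, map_mul, Units.val_mul]
        ring
      | zero => simp
      | add a b _ _ ha hb => rw [mul_add, map_add, map_add, add_mul, mul_add, ha, hb]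
    | zero => simp
    | add a b _ _ ha hb => rw [add_mul, map_add, map_add, add_mul, add_mul, ha, hb]
  have hcc : (↑c⁻¹ : R) * φ 1 = 1 := by rw [← hc]; simp
  let Ψ : R ≃+* R :=
    { toFun := fun r => φ r * ↑c⁻¹
      invFun := fun r => φ.symm (r * φ 1)
      left_inv := fun r => by simp [mul_assoc, hcc]
      right_inv := fun r => by
        simp only [AddEquiv.apply_symm_apply]
        rw [mul_assoc, mul_comm (φ 1), hcc, mul_one]
      map_mul' := fun x y => by
        linear_combination (↑c⁻¹ * ↑c⁻¹ : R) * key x y - (φ (x * y) * ↑c⁻¹) * hcc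
      map_add' := fun x y => by rw [map_add, add_mul] }
  have hΨ : ∀ r, Ψ r * φ 1 = φ r := fun r => by
    change φ r * ↑c⁻¹ * φ 1 = φ r
    rw [mul_assoc, hcc, mul_one]
  refine ⟨Ψ, fun u => ?_, hΨ⟩
  have h2 : IsUnit (φ 1) := ⟨c, hc⟩
  exact h2.mul_right_cancel ((hΨ u).trans (h u).symm)
end
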